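/- Let C be a category, J a small filtered category, and F : J ⥤ C a functor such that for every morphism j → j′ in J the transition map F(j) → F(j′) is a monomorphism in C. Then every morphism yoneda(X) → colim(F ⋙ yoneda) in Ind C, where X is an object of C, factors as yoneda(X) → yoneda(F(j)) followed by the colimit-cocone leg yoneda(F(j)) → colim(F ⋙ yoneda) for some object j of J; moreover this cocone leg is a monomorphism in Ind C. (This is the factorization property, condition (3) of a left s-filtering embedding, for the embedding of C into its admissible ind-objects.) -/

import Mathlib

open CategoryTheory Limits

universe v u

/-- In a filtered diagram of types with injective transition maps, the legs of a colimit cocone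
are injective. -/
theorem CategoryTheory.Limits.Types.FilteredColimit.ι_injective_of_forall_map_injective
    {J : Type v} [SmallCategory J] [IsFiltered J] {G : J ⥤ Type v} {c : Cocone G}
    (hc : IsColimit c)
    (hG : ∀ {j j' : J} (f : j ⟶ j'), Function.Injective (G.map f)) (j : J) :
    Function.Injective (c.ι.app j) := by
  intro x y hxy
  obtain ⟨k, f, hf⟩ := (Types.FilteredColimit.isColimit_eq_iff' hc x y).1 hxy
  exact hG f hf

/-- Evaluating the presheaf underlying an ind-object at `X` amounts to taking morphisms
out of `Ind.yoneda.obj X`. -/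
noncomputable def CategoryTheory.Ind.coyonedaYonedaIso {C : Type u} [Category.{v} C] (X : C) :
    coyoneda.obj (Opposite.op (Ind.yoneda.obj X)) ≅
      Ind.inclusion C ⋙ (evaluation _ _).obj (Opposite.op X) :=
  NatIso.ofComponents
    (fun A => (Ind.inclusion.fullyFaithful.homEquiv.trans
      (((Ind.yonedaCompInclusion.app X).homFromEquiv).trans yonedaEquiv)).toIso)
    (fun f => by
      ext g
      simp [yonedaEquiv, Functor.FullyFaithful.homEquiv, Iso.homFromEquiv])

/-- A leg of a filtered colimit of representables in `Ind C` along monomorphisms is a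
monomorphism. -/
theorem CategoryTheory.Ind.mono_colimit_ι_comp_yoneda {C : Type u} [Category.{v} C]
    {J : Type v} [SmallCategory J] [IsFiltered J] (F : J ⥤ C)
    (hF : ∀ {j j' : J} (f : j ⟶ j'), Mono (F.map f)) (j : J) :
    Mono (colimit.ι (F ⋙ Ind.yoneda) j) := by
  apply (Ind.inclusion C).mono_of_mono_map
  have (X : Cᵒᵖ) : Mono (((Ind.inclusion C).map (colimit.ι (F ⋙ Ind.yoneda) j)).app X) := by
    rw [mono_iff_injective]
    refine Types.FilteredColimit.ι_injective_of_forall_map_injective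
      (isColimitOfPreserves (Ind.inclusion C ⋙ (evaluation _ _).obj X)
        (colimit.isColimit (F ⋙ Ind.yoneda))) (fun {i k} f => ?_) j
    have := hF f
    have : (Ind.yoneda ⋙ Ind.inclusion C).PreservesMonomorphisms :=
      Functor.PreservesMonomorphisms.of_iso Ind.yonedaCompInclusion.symm
    rw [← mono_iff_injective]
    exact inferInstanceAs
      (Mono (((evaluation _ _).obj X).map ((Ind.yoneda ⋙ Ind.inclusion C).map (F.map f))))
  exact NatTrans.mono_of_mono_app _

/-- if `F : J ⥤ C` is a filtered diagram all of whose transition maps are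
monomorphisms, then every morphism `yoneda X ⟶ colim (F ⋙ yoneda)` in `Ind C` factors
through a colimit-cocone leg `yoneda (F j) ⟶ colim (F ⋙ yoneda)`, which is moreover a
monomorphism in `Ind C` (condition (3) of a left s-filtering embedding). -/
theorem exists_factorization_through_cocone_leg {C : Type u} [Category.{v} C]
    {J : Type v} [SmallCategory J] [IsFiltered J] (F : J ⥤ C)
    (hF : ∀ {j j' : J} (f : j ⟶ j'), Mono (F.map f)) (X : C)
    (η : Ind.yoneda.obj X ⟶ colimit (F ⋙ Ind.yoneda)) :
    ∃ (j : J) (g : X ⟶ F.obj j),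
      η = Ind.yoneda.map g ≫ colimit.ι (F ⋙ Ind.yoneda) j ∧
        Mono (colimit.ι (F ⋙ Ind.yoneda) j) := by
  have : PreservesColimitsOfShape J (coyoneda.obj (Opposite.op (Ind.yoneda.obj X))) :=
    preservesColimitsOfShape_of_natIso (Ind.coyonedaYonedaIso X).symm
  obtain ⟨j, g, hg⟩ := Types.jointly_surjective _
    (isColimitOfPreserves (coyoneda.obj (Opposite.op (Ind.yoneda.obj X)))
      (colimit.isColimit (F ⋙ Ind.yoneda))) η
  obtain ⟨g, rfl⟩ := Ind.yoneda.map_surjective g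
  exact ⟨j, g, hg.symm, Ind.mono_colimit_ι_comp_yoneda F hF j⟩
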